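/- There do not exist integers a, n such that 74a² = 2n² + 2n + 2. -/

import Mathlib

lemma descent_aux (k : ℕ) : ∀ x y : ℤ, 0 ≤ x → 0 ≤ y → y < k →
    (x ^ 2 - 37 * y ^ 2 = 3 ∨ x ^ 2 - 37 * y ^ 2 = -3) → False := by
  induction k with
  | zero => intro x y _ hy hk; simp at hk; omega
  | succ k ih =>
    intro x y hx hy hk h
    push_cast at hk
    rcases hy.eq_or_lt with h0 | h0
    · subst h0
      have : x < 2 := by rcases h with h | h <;> nlinarith
      interval_cases x <;> omega
    · have h5 : 5 * y < x := by
        by_contra hc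
        push Not at hc
        rcases h with h | h <;> nlinarith
      have h7 : x < 7 * y := by
        by_contra hc
        push Not at hc
        rcases h with h | h <;> nlinarith
      have hlt : |x - 6 * y| < y := by rw [abs_lt]; constructor <;> linarith
      refine ih |37 * y - 6 * x| |x - 6 * y| (abs_nonneg _) (abs_nonneg _) (by omega) ?_
      rw [sq_abs, sq_abs]
      rcases h with h | h
      · right; linarith
      · left; linarith

/-- There do not exist integers `a`, `n` such that `74a² = 2n² + 2n + 2`. -/
theorem stmt_15 : ¬ ∃ a n : ℤ, 74 * a ^ 2 = 2 * n ^ 2 + 2 * n + 2 := by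
  rintro ⟨a, n, h⟩
  refine descent_aux (|2 * a|.toNat + 1) |2 * n + 1| |2 * a| (abs_nonneg _) (abs_nonneg _)
    (by push_cast; omega) (Or.inr ?_)
  rw [sq_abs, sq_abs]
  linarith
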